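/- Let (T,m) be a complete local ring with prime subring Π, suppose all nonzero elements of Π are regular elements of T, and let p be a nonmaximal prime ideal of T with Π ∩ p = (0). Let G' = Ass(T) ∪ {p} and let G = {P ∈ Spec(T) : P ⊆ Q for some Q ∈ G'}. Let y_1, y_2, … be a countable collection of regular elements of T with y_i ∈ m \ p for all i. Then there exists a local domain A ⊆ T such that: (1) the (m∩A)-adic completion of A is isomorphic to T; (2) A ∩ p = (0); (3) for every i there is a unit t_i of T with y_i t_i ∈ A; (4) {q ∈ Spec(T) : q ∩ A = (0)} = G; and (5) if J is a nonzero prime ideal of A then T ⊗_A κ(J) ≅ κ(J), where κ(J) = A_J/JA_J. -/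

import Mathlib

open IsLocalRing

/-- The `q`-th Frobenius power `I^{[q]}` of an ideal: the ideal generated by `q`-th powers of
elements of `I`. -/
def Ideal.frobPow {R : Type*} [CommRing R] (I : Ideal R) (q : ℕ) : Ideal R :=
  Ideal.span ((fun r => r ^ q) '' (I : Set R))

/-- Membership in the tight closure `I*` of an ideal `I` in a ring of characteristic `p`:
there is a `c` outside every minimal prime with `c * x^{p^e} ∈ I^{[p^e]}` for all `e ≫ 0`. -/
def Ideal.MemTightClosure {R : Type*} [CommRing R] (p : ℕ) (I : Ideal R) (x : R) : Prop :=
  ∃ c : R, (∀ P ∈ minimalPrimes R, c ∉ P) ∧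
    ∃ E : ℕ, ∀ e : ℕ, E ≤ e → c * x ^ p ^ e ∈ I.frobPow (p ^ e)

/-- A ring of characteristic `p` is weakly F-regular if every ideal is tightly closed. -/
def WeaklyFRegular (R : Type*) [CommRing R] (p : ℕ) : Prop :=
  ∀ (I : Ideal R) (x : R), I.MemTightClosure p x → x ∈ I

/-- A ring is F-regular if all of its localizations are weakly F-regular. -/
def FRegular (R : Type*) [CommRing R] (p : ℕ) : Prop :=
  ∀ S : Submonoid R, WeaklyFRegular (Localization S) p

/-- A ring is catenary if any two saturated chains of primes with the same endpoints have
the same length. -/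
def IsCatenaryRing (R : Type*) [CommRing R] : Prop :=
  ∀ (n m : ℕ) (f : Fin (n + 1) → PrimeSpectrum R) (g : Fin (m + 1) → PrimeSpectrum R),
    f 0 = g 0 → f (Fin.last n) = g (Fin.last m) →
    (∀ i : Fin n, f i.castSucc ⋖ f i.succ) → (∀ i : Fin m, g i.castSucc ⋖ g i.succ) →
    n = m

/-- `y` generates the socle of `T/I`, i.e. `(I : m) = I + (y)` and `y ∉ I`. -/
def IsSocleGenerator {T : Type*} [CommRing T] [IsLocalRing T] (I : Ideal T) (y : T) : Prop :=
  y ∉ I ∧ I.colon (maximalIdeal T) = I ⊔ Ideal.span {y}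

/-- An approximately Gorenstein sequence: a descending chain of `m`-primary ideals with
Gorenstein quotients, cofinal with the powers of `m`. -/
def IsApproxGorensteinSeq (T : Type*) [CommRing T] [IsLocalRing T] (I : ℕ → Ideal T) : Prop :=
  Antitone I ∧ (∀ s, (I s).radical = maximalIdeal T) ∧
  (∀ s, ∃ y, IsSocleGenerator (I s) y) ∧
  ∀ N : ℕ, ∃ S : ℕ, ∀ s : ℕ, S ≤ s → I s ≤ maximalIdeal T ^ N

/-- The set `M_{I,y} = ⋃_{e ≥ 1} ⋂_{f ≥ e} (I^{[p^f]} : y^{p^f})`. -/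
def MIy {T : Type*} [CommRing T] (p : ℕ) (I : Ideal T) (y : T) : Set T :=
  {c : T | ∃ e : ℕ, 1 ≤ e ∧ ∀ f : ℕ, e ≤ f → c * y ^ p ^ f ∈ I.frobPow (p ^ f)}

/-- `depth T ≥ n`: there is a regular sequence of length `n` in the maximal ideal. -/
def DepthGE (T : Type*) [CommRing T] [IsLocalRing T] (n : ℕ) : Prop :=
  ∃ rs : List T, rs.length = n ∧ (∀ x ∈ rs, x ∈ maximalIdeal T) ∧
    RingTheory.Sequence.IsRegular T rs

/-- A Noetherian local ring is Cohen–Macaulay iff there is a regular sequence in the maximal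
ideal of length equal to the Krull dimension. -/
def IsCohenMacaulayLocal (T : Type*) [CommRing T] [IsLocalRing T] : Prop :=
  ∃ rs : List T, (∀ x ∈ rs, x ∈ maximalIdeal T) ∧ RingTheory.Sequence.IsRegular T rs ∧
    (rs.length : WithBot (WithTop ℕ)) = ringKrullDim T

/-- A parameter ideal: generated by `dim T` elements, with radical the maximal ideal. -/
def IsParameterIdeal (T : Type*) [CommRing T] [IsLocalRing T] (I : Ideal T) : Prop :=
  ∃ (n : ℕ) (x : Fin n → T), I = Ideal.span (Set.range x) ∧ I.radical = maximalIdeal T ∧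
    (n : WithBot (WithTop ℕ)) = ringKrullDim T

/-- A Noetherian local ring is Gorenstein iff it is Cohen–Macaulay and every parameter ideal
is irreducible (has one-dimensional socle). -/
def IsGorensteinLocal (T : Type*) [CommRing T] [IsLocalRing T] : Prop :=
  IsCohenMacaulayLocal T ∧ ∀ I : Ideal T, IsParameterIdeal T I → ∃ y, IsSocleGenerator I y

/-- A `p`-subring of a local ring `T`: a quasi-local subring `(R, R ∩ m)` which is small,
misses `p`, and misses every associated prime of `T`. -/
def IsPSubring (T : Type*) [CommRing T] [IsLocalRing T] (P : Ideal T) (R : Subring T) : Prop :=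
  IsLocalRing R ∧ (Ideal.comap R.subtype (maximalIdeal T)).IsMaximal ∧
  (Cardinal.mk R ≤ max Cardinal.aleph0 (Cardinal.mk (ResidueField T)) ∧
    (Cardinal.mk R = max Cardinal.aleph0 (Cardinal.mk (ResidueField T)) →
      Cardinal.mk (ResidueField T) ≤ Cardinal.aleph0)) ∧
  Ideal.comap R.subtype P = ⊥ ∧
  ∀ Q ∈ associatedPrimes T T, Ideal.comap R.subtype Q = ⊥

/-- An N-subring of a local ring `T`: a quasi-local UFD `(R, R ∩ m)` inside `T` which is small,
misses every associated prime of `T`, and such that `R ∩ J` has height at most one for every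
`J ∈ Ass(T/tT)`, `t` a nonzerodivisor. -/
def IsNSubring (T : Type*) [CommRing T] [IsLocalRing T] (R : Subring T) : Prop :=
  IsLocalRing R ∧ (Ideal.comap R.subtype (maximalIdeal T)).IsMaximal ∧
  (∃ _ : IsDomain R, UniqueFactorizationMonoid R) ∧
  (Cardinal.mk R ≤ max Cardinal.aleph0 (Cardinal.mk (ResidueField T)) ∧
    (Cardinal.mk R = max Cardinal.aleph0 (Cardinal.mk (ResidueField T)) →
      Cardinal.mk (ResidueField T) ≤ Cardinal.aleph0)) ∧
  (∀ Q ∈ associatedPrimes T T, Ideal.comap R.subtype Q = ⊥) ∧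
  ∀ t ∈ nonZeroDivisors T, ∀ J ∈ associatedPrimes T (T ⧸ Ideal.span {t}),
    ∀ q0 q1 : Ideal R, q0.IsPrime → q1.IsPrime →
      ¬(q0 < q1 ∧ q1 < Ideal.comap R.subtype J)

section

open Cardinal
open scoped TensorProduct

/-- A complete Noetherian local ring has at most `#k ^ ℵ₀` elements, `k` its residue field. -/
theorem IsLocalRing.mk_le_mk_nat_arrow_residueField (T : Type*) [CommRing T] [IsLocalRing T]
    [IsNoetherianRing T] [IsHausdorff (maximalIdeal T) T] :
    #T ≤ #(ℕ → ResidueField T) := by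
  obtain ⟨s, hs⟩ : ∃ s : Finset T, Ideal.span (s : Set T) = maximalIdeal T :=
    (maximalIdeal T).fg_of_isNoetherianRing
  obtain ⟨σ, hσ⟩ := (residue_surjective (R := T)).hasRightInverse
  have hd : ∀ t : T, ∃ d : s → T, t - σ (residue T t) = ∑ i, d i * (i : T) := by
    intro t
    have : t - σ (residue T t) ∈ Ideal.span (s : Set T) := by
      rw [hs, ← residue_eq_zero_iff, map_sub, hσ, sub_self]
    obtain ⟨d, hd⟩ := (Submodule.mem_span_finset' (R := T)).1 this
    exact ⟨d, by simpa using hd.symm⟩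
  choose d hd using hd
  let code : T → List s → ResidueField T :=
    fun t w => residue T (w.foldl (fun t i => d t i) t)
  have key : ∀ n : ℕ, ∀ t t' : T, code t = code t' → t - t' ∈ maximalIdeal T ^ n := by
    intro n
    induction n with
    | zero => intro t t' _; simp
    | succ n ih =>
      intro t t' h
      have h0 : residue T t = residue T t' := congrFun h []
      have h1 : t - t' = ∑ i, (d t i - d t' i) * (i : T) := by
        simp only [sub_mul, Finset.sum_sub_distrib, ← hd, h0]
        ring
      rw [h1, pow_succ]
      refine Ideal.sum_mem _ fun i _ => Ideal.mul_mem_mul (ih _ _ ?_) ?_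
      · funext w
        exact congrFun h (i :: w)
      · rw [← hs]
        exact Ideal.subset_span i.2
  have inj : Function.Injective code := by
    intro t t' h
    refine (IsHausdorff.eq_iff_smodEq (I := maximalIdeal T)).2 fun n => ?_
    rw [SModEq.sub_mem]
    simpa using key n t t' h
  obtain ⟨e, he⟩ := exists_injective_nat (List s)
  have : Function.Injective (fun t : T => fun n => code t ((Function.invFun e) n)) := by
    intro t t' h
    apply inj
    funext w
    have := congrFun h (e w)
    simpa [Function.leftInverse_invFun he w] using this
  exact mk_le_of_injective this

/-- Power series in a fixed element `z` of the maximal ideal, with coefficients lifted from the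
residue field, are pairwise incongruent modulo every prime not containing `z`. -/
theorem IsLocalRing.exists_nat_arrow_residueField_injective_mod (T : Type*) [CommRing T]
    [IsLocalRing T] [IsAdicComplete (maximalIdeal T) T] (z : T) (hz : z ∈ maximalIdeal T) :
    ∃ F : (ℕ → ResidueField T) → T, ∀ Q : Ideal T, Q.IsPrime → z ∉ Q →
      ∀ a b, F a - F b ∈ Q → a = b := by
  obtain ⟨σ, hσ⟩ := (residue_surjective (R := T)).hasRightInverse
  let S : ℕ → (ℕ → ResidueField T) → T :=
    fun n => n.rec (fun _ => 0) fun _ f a => σ (a 0) + z * f (fun i => a (i + 1))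
  have hS : ∀ n a, S (n + 1) a = σ (a 0) + z * S n (fun i => a (i + 1)) := fun _ _ => rfl
  have hcauchy : ∀ n k a, S (n + k) a - S n a ∈ maximalIdeal T ^ n := by
    intro n
    induction n with
    | zero => simp
    | succ n ih =>
      intro k a
      rw [show n + 1 + k = (n + k) + 1 by omega, hS, hS, pow_succ']
      rw [add_sub_add_left_eq_sub, ← mul_sub]
      exact Ideal.mul_mem_mul hz (ih k _)
  have hlim : ∀ a, ∃ L : T, ∀ n, S n a - L ∈ maximalIdeal T ^ n := by
    intro a
    obtain ⟨L, hL⟩ := IsPrecomplete.prec (I := maximalIdeal T) (M := T) inferInstance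
      (f := fun n => S n a) (by
        intro m n hmn
        obtain ⟨k, rfl⟩ := Nat.exists_eq_add_of_le hmn
        refine SModEq.symm ?_
        rw [SModEq.sub_mem]
        simpa using hcauchy m k a)
    refine ⟨L, fun n => ?_⟩
    have := hL n
    rw [SModEq.sub_mem] at this
    simpa using this
  choose F hF using hlim
  have hrec : ∀ a, F a = σ (a 0) + z * F (fun i => a (i + 1)) := by
    intro a
    refine (IsHausdorff.eq_iff_smodEq (I := maximalIdeal T)).2 fun n => ?_
    rw [SModEq.sub_mem]
    have h1 := Ideal.pow_le_pow_right (n.le_succ) (hF a (n + 1))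
    have h2 := Ideal.mul_mem_left _ z (hF (fun i => a (i + 1)) n)
    have := sub_mem h2 h1
    rw [hS] at this
    simp only [smul_eq_mul, Ideal.mul_top]
    convert this using 1
    ring
  refine ⟨F, fun Q hQ hzQ a b hab => ?_⟩
  have key : ∀ n a b, F a - F b ∈ Q → a n = b n := by
    intro n
    have h0 : ∀ a b, F a - F b ∈ Q → a 0 = b 0 := by
      intro a b hab
      have := le_maximalIdeal hQ.ne_top hab
      rw [← residue_eq_zero_iff, hrec a, hrec b] at this
      simpa [(residue_eq_zero_iff z).2 hz, hσ _, sub_eq_zero] using this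
    induction n with
    | zero => exact h0
    | succ n ih =>
      intro a b hab
      refine ih (fun i => a (i + 1)) (fun i => b (i + 1)) ?_
      have h00 := h0 a b hab
      rw [hrec a, hrec b, h00, add_sub_add_left_eq_sub, ← mul_sub] at hab
      exact (hQ.mem_or_mem hab).resolve_left hzQ
  exact funext fun n => key n a b hab

theorem Cardinal.aleph0_lt_mk_nat_arrow (k : Type*) [Nontrivial k] : ℵ₀ < #(ℕ → k) :=
  calc ℵ₀ < 2 ^ ℵ₀ := cantor _
    _ ≤ #k ^ ℵ₀ := power_le_power_right (two_le_iff.2 (exists_pair_ne k))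
    _ = _ := by simp

/-- A generic element of a coset `u + I` can be adjoined to a small subring meeting the primes of
a finite set trivially, without destroying this property. -/
theorem IsLocalRing.exists_sub_mem_and_adjoin_insert_inf_eq_zero {T : Type*} [CommRing T]
    [IsLocalRing T] [IsAdicComplete (maximalIdeal T) T] {E : Set (Ideal T)} (hfin : E.Finite)
    (hprime : ∀ Q ∈ E, Q.IsPrime) (hmax : maximalIdeal T ∉ E) {s : Set T}
    (hcard : #s < #(ℕ → ResidueField T))
    (hs : ∀ Q ∈ E, ∀ x ∈ Algebra.adjoin ℤ s, x ∈ Q → x = 0)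
    (u : T) {I : Ideal T} (hI : ∀ Q ∈ E, ¬ I ≤ Q) :
    ∃ v, v - u ∈ I ∧ ∀ Q ∈ E, ∀ x ∈ Algebra.adjoin ℤ (insert v s), x ∈ Q → x = 0 := by
  have avoid : ∀ J : Ideal T, (∀ Q ∈ E, ¬ J ≤ Q) → ∃ w ∈ J, ∀ Q ∈ E, w ∉ Q := by
    intro J hJ
    have := mt (Ideal.subset_union_prime_finite hfin (f := id) ⊤ ⊤
      (fun i hi _ _ => hprime i hi) (I := J)).1 (by push Not; exact hJ)
    obtain ⟨w, hwJ, hw⟩ := Set.not_subset.1 this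
    exact ⟨w, hwJ, fun Q hQ hwQ => hw (Set.mem_biUnion hQ hwQ)⟩
  obtain ⟨w, hwI, hw⟩ := avoid I hI
  obtain ⟨z, hzm, hz⟩ := avoid (maximalIdeal T) fun Q hQ hle =>
    hmax ((le_antisymm hle (le_maximalIdeal (hprime Q hQ).ne_top)) ▸ hQ)
  obtain ⟨F, hF⟩ := exists_nat_arrow_residueField_injective_mod T z hzm
  let R := Algebra.adjoin ℤ s
  have hinf := aleph0_lt_mk_nat_arrow (ResidueField T)
  have : Infinite (ℕ → ResidueField T) := infinite_iff.2 hinf.le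
  have : Finite E := hfin
  have hR : #R < #(ℕ → ResidueField T) := by
    refine lt_of_le_of_lt (b := max #s ℵ₀) ?_ (max_lt hcard hinf)
    have := Algebra.lift_cardinalMk_adjoin_le ℤ s
    simpa [R, or_comm] using this
  have hRX : #(E × Polynomial R) < #(ℕ → ResidueField T) := by
    rw [mk_prod, Cardinal.lift_id, Cardinal.lift_id]
    refine mul_lt_of_lt hinf.le ((lt_aleph0_of_finite E).trans hinf) ?_
    exact lt_of_le_of_lt Polynomial.cardinalMk_le_max (max_lt hR hinf)
  have haeval : ∀ v x, x ∈ Algebra.adjoin ℤ (insert v s) →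
      ∃ f : Polynomial R, Polynomial.aeval v f = x := by
    intro v x hx
    rw [← Set.union_singleton, Algebra.adjoin_union_eq_adjoin_adjoin,
      Subalgebra.mem_restrictScalars] at hx
    exact Algebra.adjoin_mem_exists_aeval _ _ hx
  classical
  by_contra! hbad
  have : ∀ a : ℕ → ResidueField T, ∃ c : E × Polynomial R, c.2 ≠ 0 ∧
      Polynomial.aeval (u + w * F a) c.2 ∈ c.1.1 := by
    intro a
    obtain ⟨Q, hQ, x, hx, hxQ, hx0⟩ := hbad (u + w * F a)
      (by rw [add_sub_cancel_left]; exact I.mul_mem_right _ hwI)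
    obtain ⟨f, rfl⟩ := haeval _ _ hx
    exact ⟨(⟨Q, hQ⟩, f), by rintro rfl; simp at hx0, hxQ⟩
  choose c hc0 hc using this
  obtain ⟨⟨⟨Q, hQ⟩, f⟩, hfib⟩ := exists_infinite_fiber c hRX
  have := hprime Q hQ
  let φ : R →+* T ⧸ Q := (Ideal.Quotient.mk Q).comp (algebraMap R T)
  have hφ : Function.Injective φ := by
    refine (injective_iff_map_eq_zero φ).2 fun x hx => ?_
    exact Subtype.ext (hs Q hQ x x.2 (Ideal.Quotient.eq_zero_iff_mem.1 hx))
  let g : (c ⁻¹' {(⟨Q, hQ⟩, f)} : Set (ℕ → ResidueField T)) → T ⧸ Q :=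
    fun a => Ideal.Quotient.mk Q (u + w * F a)
  have hg : Function.Injective g := by
    intro a b hab
    refine Subtype.ext (hF Q this (hz Q hQ) _ _ ?_)
    have := Ideal.Quotient.eq.1 hab
    rw [add_sub_add_left_eq_sub, ← mul_sub] at this
    exact (‹Q.IsPrime›.mem_or_mem this).resolve_left (hw Q hQ)
  have hf0 : f ≠ 0 := by
    obtain ⟨a, ha⟩ := (inferInstance : Nonempty (c ⁻¹' {(⟨Q, hQ⟩, f)} : Set _))
    have := hc0 a
    rwa [show c a = _ from ha] at this
  have hroots : Set.range g ⊆ {x | x ∈ (f.map φ).roots.toFinset} := by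
    rintro _ ⟨a, rfl⟩
    have h1 := hc a
    rw [show c a = _ from a.2] at h1
    simp only [Set.mem_ofPred_eq, Multiset.mem_toFinset]
    rw [Polynomial.mem_roots (by rwa [Ne, Polynomial.map_eq_zero_iff hφ]), Polynomial.IsRoot,
      Polynomial.eval_map, ← Polynomial.hom_eval₂, ← Polynomial.aeval_def]
    exact Ideal.Quotient.eq_zero_iff_mem.2 h1
  exact Set.infinite_range_of_injective hg
    ((Finset.finite_toSet (f.map φ).roots.toFinset).subset hroots)

/-- There is a subring meeting the primes of a finite set trivially and meeting every coset of
every ideal contained in none of these primes. -/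
theorem IsLocalRing.exists_subring_meets_cosets {T : Type*} [CommRing T]
    [IsLocalRing T] [IsNoetherianRing T] [IsAdicComplete (maximalIdeal T) T] {E : Set (Ideal T)}
    (hfin : E.Finite) (hprime : ∀ Q ∈ E, Q.IsPrime) (hmax : maximalIdeal T ∉ E)
    (hint : ∀ Q ∈ E, ∀ x ∈ (Int.castRingHom T).range, x ∈ Q → x = 0) :
    ∃ A : Subring T, (∀ Q ∈ E, ∀ x ∈ A, x ∈ Q → x = 0) ∧
      ∀ (u : T) (I : Ideal T), (∀ Q ∈ E, ¬ I ≤ Q) → ∃ v ∈ A, v - u ∈ I := by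
  let Good : Set T → Prop := fun s => ∀ Q ∈ E, ∀ x ∈ Algebra.adjoin ℤ s, x ∈ Q → x = 0
  let Ω := (#(T × List T)).ord.ToType
  obtain ⟨e⟩ : Nonempty (Ω ≃ T × List T) := Cardinal.eq.1 (mk_ord_toType _)
  let ideal : Ω → Ideal T := fun α => Ideal.span {x | x ∈ (e α).2}
  have hΩ : #Ω ≤ #(ℕ → ResidueField T) := by
    have hT := mk_le_mk_nat_arrow_residueField T
    have hinf := (aleph0_lt_mk_nat_arrow (ResidueField T)).le
    rw [Cardinal.mk_ord_toType, mk_prod, Cardinal.lift_id, Cardinal.lift_id]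
    exact mul_le_of_le hinf hT ((mk_list_le_max T).trans (max_le hinf hT))
  have step : ∀ (α : Ω) (s : Set T), ∃ v, #s < #(ℕ → ResidueField T) → Good s →
      Good (insert v s) ∧ ((∀ Q ∈ E, ¬ ideal α ≤ Q) → v - (e α).1 ∈ ideal α) := by
    intro α s
    by_cases h : #s < #(ℕ → ResidueField T) ∧ Good s
    · by_cases hI : ∀ Q ∈ E, ¬ ideal α ≤ Q
      · obtain ⟨v, hv, hv'⟩ := exists_sub_mem_and_adjoin_insert_inf_eq_zero hfin hprime hmax
          h.1 h.2 (e α).1 hI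
        exact ⟨v, fun _ _ => ⟨hv', fun _ => hv⟩⟩
      · refine ⟨0, fun _ hs => ⟨?_, fun h => absurd h hI⟩⟩
        simpa [Good] using hs
    · exact ⟨0, fun h1 h2 => absurd ⟨h1, h2⟩ h⟩
  choose next hnext using step
  let v : Ω → T := (wellFounded_lt (α := Ω)).fix
    fun α rec => next α (Set.range fun β : Set.Iio α => rec β.1 β.2)
  have hv : ∀ α, v α = next α (v '' Set.Iio α) := by
    intro α
    rw [Set.image_eq_range]
    exact (wellFounded_lt (α := Ω)).fix_eq _ α
  have hcard : ∀ α, #(v '' Set.Iio α) < #(ℕ → ResidueField T) := fun α =>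
    (mk_image_le.trans_lt (mk_Iio_lt α (by simp [Ω]))).trans_le hΩ
  have hfinset : ∀ S : Set Ω, ∀ x ∈ Algebra.adjoin ℤ (v '' S),
      ∃ t : Finset Ω, (t : Set Ω) ⊆ S ∧ x ∈ Algebra.adjoin ℤ (v '' t) := by
    classical
    intro S x hx
    have hmono : ∀ t t' : Finset Ω, t ⊆ t' →
        Algebra.adjoin ℤ (v '' t) ≤ Algebra.adjoin ℤ (v '' t') := fun t t' h =>
      Algebra.adjoin_mono (Set.image_mono (by exact_mod_cast h))
    induction hx using Algebra.adjoin_induction with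
    | mem x hx =>
      obtain ⟨β, hβ, rfl⟩ := hx
      exact ⟨{β}, by simpa using hβ, Algebra.subset_adjoin ⟨β, by simp, rfl⟩⟩
    | algebraMap n => exact ⟨∅, by simp, Subalgebra.algebraMap_mem _ n⟩
    | add x y _ _ hx hy =>
      obtain ⟨t, ht, hxt⟩ := hx
      obtain ⟨t', ht', hyt⟩ := hy
      exact ⟨t ∪ t', by simp [ht, ht'], add_mem (hmono _ _ Finset.subset_union_left hxt)
        (hmono _ _ Finset.subset_union_right hyt)⟩
    | mul x y _ _ hx hy =>
      obtain ⟨t, ht, hxt⟩ := hx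
      obtain ⟨t', ht', hyt⟩ := hy
      exact ⟨t ∪ t', by simp [ht, ht'], mul_mem (hmono _ _ Finset.subset_union_left hxt)
        (hmono _ _ Finset.subset_union_right hyt)⟩
  have hlimit : ∀ S : Set Ω, (∀ β ∈ S, Good (v '' Set.Iio β)) → Good (v '' S) := by
    intro S hS Q hQ x hx hxQ
    obtain ⟨t, htS, hxt⟩ := hfinset S x hx
    rcases t.eq_empty_or_nonempty with rfl | hne
    · refine hint Q hQ x ?_ hxQ
      simpa [Algebra.mem_bot] using hxt
    · have hβ := hS _ (htS (t.max'_mem hne))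
      have h := (hnext (t.max' hne) _ (hcard _) hβ).1 Q hQ x
      rw [← hv] at h
      refine h (Algebra.adjoin_mono ?_ hxt) hxQ
      rintro _ ⟨γ, hγ, rfl⟩
      rcases (t.le_max' γ hγ).eq_or_lt with hEq | hlt
      · exact Or.inl (by rw [hEq])
      · exact Or.inr ⟨γ, hlt, rfl⟩
  have hgood : ∀ α, Good (v '' Set.Iio α) := by
    intro α
    induction α using WellFoundedLT.induction with
    | ind α ih => exact hlimit _ fun β hβ => ih β hβ
  refine ⟨(Algebra.adjoin ℤ (v '' Set.univ)).toSubring, hlimit _ fun β _ => hgood β, ?_⟩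
  intro u I hI
  obtain ⟨s, rfl⟩ : ∃ s : Finset T, Ideal.span (s : Set T) = I := I.fg_of_isNoetherianRing
  have hα : ideal (e.symm (u, s.toList)) = Ideal.span (s : Set T) := by
    simp only [ideal, Equiv.apply_symm_apply, Finset.mem_toList]
    rfl
  have h := (hnext (e.symm (u, s.toList)) _ (hcard (e.symm (u, s.toList)))
    (hgood _)).2
  rw [hα, ← hv] at h
  refine ⟨v (e.symm (u, s.toList)), Algebra.subset_adjoin ⟨_, trivial, rfl⟩, ?_⟩
  simpa using h hI

/-- The elements of `T` that become elements of `A` after multiplication by a regular element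
of `A`. -/
def Subring.regularSaturation {T : Type*} [CommRing T] (A : Subring T) : Subring T where
  carrier := {t | ∃ a ∈ A, a ∈ nonZeroDivisors T ∧ a * t ∈ A}
  zero_mem' := ⟨1, one_mem _, one_mem _, by simp⟩
  one_mem' := ⟨1, one_mem _, one_mem _, by simp⟩
  add_mem' := by
    rintro s t ⟨a, ha, ha', has⟩ ⟨b, hb, hb', hbt⟩
    refine ⟨a * b, mul_mem ha hb, mul_mem ha' hb', ?_⟩
    rw [show a * b * (s + t) = b * (a * s) + a * (b * t) by ring]
    exact add_mem (mul_mem hb has) (mul_mem ha hbt)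
  mul_mem' := by
    rintro s t ⟨a, ha, ha', has⟩ ⟨b, hb, hb', hbt⟩
    refine ⟨a * b, mul_mem ha hb, mul_mem ha' hb', ?_⟩
    rw [show a * b * (s * t) = (a * s) * (b * t) by ring]
    exact mul_mem has hbt
  neg_mem' := by
    rintro t ⟨a, ha, ha', hat⟩
    exact ⟨a, ha, ha', by rw [mul_neg]; exact neg_mem hat⟩

theorem Subring.le_regularSaturation {T : Type*} [CommRing T] (A : Subring T) :
    A ≤ A.regularSaturation :=
  fun t ht => ⟨1, one_mem _, one_mem _, by simpa using ht⟩

theorem Subring.mem_regularSaturation_of_mul_mem {T : Type*} [CommRing T] {A : Subring T}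
    {a t : T} (ha : a ∈ A.regularSaturation) (ha' : a ∈ nonZeroDivisors T)
    (hat : a * t ∈ A.regularSaturation) : t ∈ A.regularSaturation := by
  obtain ⟨b, hb, hb', hba⟩ := ha
  obtain ⟨c, hc, hc', hcat⟩ := hat
  refine ⟨c * (b * a), mul_mem hc hba, mul_mem hc' (mul_mem hb' ha'), ?_⟩
  rw [show c * (b * a) * t = b * (c * (a * t)) by ring]
  exact mul_mem hb hcat

theorem Subring.eq_zero_of_mem_regularSaturation {T : Type*} [CommRing T] {A : Subring T}
    {Q : Ideal T} (hA : ∀ x ∈ A, x ∈ Q → x = 0) {x : T} (hx : x ∈ A.regularSaturation)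
    (hxQ : x ∈ Q) : x = 0 := by
  obtain ⟨a, -, ha, hax⟩ := hx
  exact (mul_left_mem_nonZeroDivisors_eq_zero_iff ha).1 (hA _ hax (Q.mul_mem_left a hxQ))

/-- If every nonzero element `a` of `A` satisfies `aT ∩ A = aA` and `A → T/aT` is onto, then
ideals of `A` are contracted from `T`. -/
theorem Subring.comap_map_of_surjective_mod {T : Type*} [CommRing T] {A : Subring T}
    (hclosed : ∀ a ∈ A, a ≠ 0 → ∀ t, a * t ∈ A → t ∈ A)
    (hsurj : ∀ a ∈ A, a ≠ 0 → ∀ u : T, ∃ v ∈ A, v - u ∈ Ideal.span {a}) (J : Ideal A) :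
    (J.map A.subtype).comap A.subtype = J := by
  refine le_antisymm (fun x hx => ?_) Ideal.le_comap_map
  rcases eq_or_ne J ⊥ with rfl | hJ
  · simpa using hx
  obtain ⟨a, haJ, ha0⟩ := Submodule.exists_mem_ne_zero_of_ne_bot hJ
  have ha0' : (a : T) ≠ 0 := fun h => ha0 (Subtype.ext h)
  have key : ∀ y ∈ J.map A.subtype, ∃ j ∈ J, y - j ∈ Ideal.span {(a : T)} := by
    intro y hy
    induction hy using Submodule.span_induction with
    | mem y hy =>
      obtain ⟨j, hj, rfl⟩ := hy
      exact ⟨j, hj, by simp⟩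
    | zero => exact ⟨0, zero_mem _, by simp⟩
    | add y y' _ _ ih ih' =>
      obtain ⟨j, hj, h⟩ := ih
      obtain ⟨j', hj', h'⟩ := ih'
      refine ⟨j + j', add_mem hj hj', ?_⟩
      convert add_mem h h' using 1
      push_cast
      ring
    | smul t y _ ih =>
      obtain ⟨j, hj, h⟩ := ih
      obtain ⟨b, hb, hbt⟩ := hsurj a a.2 ha0' t
      refine ⟨⟨b, hb⟩ * j, J.mul_mem_left _ hj, ?_⟩
      convert sub_mem (Ideal.mul_mem_left _ t h) (Ideal.mul_mem_left _ (j : T) hbt) using 1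
      simp only [smul_eq_mul, Subring.coe_mul]
      ring
  obtain ⟨j, hj, h⟩ := key x hx
  obtain ⟨t, ht⟩ := Ideal.mem_span_singleton'.1 h
  have htA : t ∈ A := hclosed a a.2 ha0' t (by
    rw [mul_comm, ht]
    exact sub_mem x.2 j.2)
  have : x = j + ⟨t, htA⟩ * a := Subtype.ext (by
    push_cast
    rw [ht]
    ring)
  rw [this]
  exact add_mem hj (J.mul_mem_left _ haJ)

theorem RingHom.isNoetherianRing_of_comap_map {A T : Type*} [CommRing A] [CommRing T]
    [IsNoetherianRing T] (f : A →+* T) (h : ∀ J : Ideal A, (J.map f).comap f = J) :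
    IsNoetherianRing A := by
  rw [isNoetherianRing_iff, isNoetherian_iff']
  have hinj : Function.Injective (Ideal.map f) := fun J J' hJ => by rw [← h J, hJ, h J']
  have : StrictMono (Ideal.map f) :=
    Monotone.strictMono_of_injective (fun _ _ => Ideal.map_mono) hinj
  exact this.wellFoundedGT

/-- A ring homomorphism inducing isomorphisms `A/nᵏ ≅ T/mᵏ` into an `m`-adically complete ring
identifies the `n`-adic completion of `A` with `T`. -/
theorem AdicCompletion.nonempty_ringEquiv_of_comap_pow {A T : Type*} [CommRing A] [CommRing T]
    (f : A →+* T) (n : Ideal A) (m : Ideal T) [IsAdicComplete m T]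
    (hcomap : ∀ k, (m ^ k).comap f = n ^ k) (hsurj : ∀ k t, ∃ a, f a - t ∈ m ^ k) :
    Nonempty (AdicCompletion n A ≃+* T) := by
  let g : (k : ℕ) → AdicCompletion n A →+* T ⧸ m ^ k := fun k =>
    (Ideal.quotientMap (m ^ k) f (hcomap k).ge).comp
      (AdicCompletion.evalₐ n k : AdicCompletion n A →+* A ⧸ n ^ k)
  have hg : ∀ {k l : ℕ} (hle : k ≤ l), (Ideal.Quotient.factorPow m hle).comp (g l) = g k := by
    intro k l hle
    ext x
    obtain ⟨x, rfl⟩ := AdicCompletion.mk_surjective n A x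
    simp only [g, RingHom.coe_comp, Function.comp_apply, RingHom.coe_coe, AdicCompletion.evalₐ_mk,
      Ideal.quotientMap_mk]
    rw [Ideal.Quotient.factorPow, Ideal.Quotient.factor_mk, Ideal.Quotient.eq, ← map_sub,
      ← Ideal.mem_comap, hcomap, ← Ideal.Quotient.eq]
    exact (AdicCompletion.Ideal.mk_eq_mk n hle x)
  let F := IsAdicComplete.liftRingHom m g hg
  have hF : ∀ k x, Ideal.Quotient.mk (m ^ k) (F x) = g k x :=
    fun k x => IsAdicComplete.mk_liftRingHom m g hg k x
  refine ⟨RingEquiv.ofBijective F ⟨?_, ?_⟩⟩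
  · refine (injective_iff_map_eq_zero F).2 fun x hx => AdicCompletion.ext_evalₐ fun k => ?_
    have h := hF k x
    rw [hx, _root_.map_zero] at h
    rw [_root_.map_zero]
    exact (injective_iff_map_eq_zero _).1
      (Ideal.quotientMap_injective' (H := (hcomap k).ge) (hcomap k).le) _ h.symm
  · intro t
    choose a ha using fun k => hsurj k t
    have hcauchy : ∀ k, a k ≡ a (k + 1) [SMOD (n ^ k • ⊤ : Submodule A A)] := by
      intro k
      rw [SModEq.sub_mem, smul_eq_mul, Ideal.mul_top, ← hcomap, Ideal.mem_comap, map_sub]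
      convert sub_mem (ha k) (Ideal.pow_le_pow_right k.le_succ (ha (k + 1))) using 1
      ring
    refine ⟨AdicCompletion.mk n A (AdicCompletion.AdicCauchySequence.mk n A a hcauchy), ?_⟩
    refine (IsHausdorff.eq_iff_smodEq (I := m)).2 fun k => ?_
    rw [SModEq.sub_mem, smul_eq_mul, Ideal.mul_top, ← Ideal.Quotient.eq, hF]
    simp only [g, RingHom.coe_comp, Function.comp_apply, RingHom.coe_coe, AdicCompletion.evalₐ_mk,
      Ideal.quotientMap_mk]
    exact Ideal.Quotient.eq.2 (ha k)

/-- If `A/J ≅ T/JT`, then `T ⊗[A] κ ≅ κ` for every `A/J`-algebra `κ`. -/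
theorem Algebra.TensorProduct.nonempty_ringEquiv_of_comap_map {A T κ : Type*} [CommRing A]
    [CommRing T] [CommRing κ] [Algebra A T] [Algebra A κ] (J : Ideal A)
    (hκ : ∀ j ∈ J, algebraMap A κ j = 0)
    (hcomap : (J.map (algebraMap A T)).comap (algebraMap A T) = J)
    (hsurj : ∀ t : T, ∃ a, algebraMap A T a - t ∈ J.map (algebraMap A T)) :
    Nonempty (TensorProduct A T κ ≃+* κ) := by
  let K := J.map (algebraMap A T)
  let q : A →+* T ⧸ K := (Ideal.Quotient.mk K).comp (algebraMap A T)
  have hq : Function.Surjective q := by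
    intro x
    obtain ⟨t, rfl⟩ := Ideal.Quotient.mk_surjective x
    obtain ⟨a, ha⟩ := hsurj t
    exact ⟨a, Ideal.Quotient.eq.2 ha⟩
  have hker : RingHom.ker q ≤ RingHom.ker (algebraMap A κ) := by
    intro a ha
    refine hκ a ?_
    rw [← hcomap, Ideal.mem_comap]
    exact Ideal.Quotient.eq_zero_iff_mem.1 ha
  let ψ : T →ₐ[A] κ :=
    { (q.liftOfSurjective hq ⟨algebraMap A κ, hker⟩).comp (Ideal.Quotient.mk K) with
      commutes' := fun a => q.liftOfRightInverse_comp_apply _ (Function.rightInverse_surjInv hq)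
        ⟨algebraMap A κ, hker⟩ a }
  let ι : κ →ₐ[A] TensorProduct A T κ := Algebra.TensorProduct.includeRight
  have hleft : Function.LeftInverse (Algebra.TensorProduct.productMap ψ (AlgHom.id A κ)) ι := by
    intro x
    simp [ι]
  have hzero : ∀ t ∈ K, ∀ x : κ, t ⊗ₜ[A] x = 0 := by
    intro t ht
    induction ht using Submodule.span_induction with
    | mem t ht =>
      obtain ⟨j, hj, rfl⟩ := ht
      intro x
      rw [Algebra.algebraMap_eq_smul_one, TensorProduct.smul_tmul, Algebra.smul_def, hκ j hj,
        zero_mul, TensorProduct.tmul_zero]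
    | zero => simp
    | add t t' _ _ h h' => intro x; rw [TensorProduct.add_tmul, h, h', add_zero]
    | smul s t _ h =>
      intro x
      rw [smul_eq_mul, ← one_mul x, ← Algebra.TensorProduct.tmul_mul_tmul, h, mul_zero]
  have hsurj' : Function.Surjective ι := by
    intro y
    induction y using TensorProduct.induction_on with
    | zero => exact ⟨0, map_zero ι⟩
    | tmul t x =>
      obtain ⟨a, ha⟩ := hsurj t
      refine ⟨a • x, ?_⟩
      have h := hzero _ ha x
      rw [TensorProduct.sub_tmul, sub_eq_zero] at h
      rw [← h, Algebra.algebraMap_eq_smul_one, TensorProduct.smul_tmul]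
      rfl
    | add y y' h h' =>
      obtain ⟨x, rfl⟩ := h
      obtain ⟨x', rfl⟩ := h'
      exact ⟨x + x', map_add ι x x'⟩
  exact ⟨(RingEquiv.ofBijective ι ⟨hleft.injective, hsurj'⟩).symm⟩

end

set_option synthInstance.maxHeartbeats 1000000 in
set_option maxHeartbeats 1000000 in
/-- SCA precompletions: local domain precompletions with prescribed
vanishing primes and trivial generic formal fibers. -/
theorem SCA_domain_precompletion
    (T : Type*) [CommRing T] [IsLocalRing T] [IsNoetherianRing T]
    [IsAdicComplete (maximalIdeal T) T]
    (hreg : ∀ x ∈ (Int.castRingHom T).range, x ≠ 0 → x ∈ nonZeroDivisors T)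
    (P : Ideal T) (hP : P.IsPrime) (hPm : P ≠ maximalIdeal T)
    (hPiP : ∀ x ∈ (Int.castRingHom T).range, x ∈ P → x = 0)
    (G' : Set (Ideal T)) (hG' : G' = associatedPrimes T T ∪ {P})
    (G : Set (Ideal T)) (hG : G = {Q : Ideal T | Q.IsPrime ∧ ∃ Q' ∈ G', Q ≤ Q'})
    (y : ℕ → T)
    (hy : ∀ i, y i ∈ nonZeroDivisors T ∧ y i ∈ maximalIdeal T ∧ y i ∉ P) :
    ∃ (A : Subring T) (_ : IsDomain A),
      IsNoetherianRing A ∧ IsLocalRing A ∧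
      (Ideal.comap A.subtype (maximalIdeal T)).IsMaximal ∧
      Nonempty (AdicCompletion (Ideal.comap A.subtype (maximalIdeal T)) A ≃+* T) ∧
      Ideal.comap A.subtype P = ⊥ ∧
      (∀ i, ∃ t : Tˣ, y i * (t : T) ∈ A) ∧
      {Q : Ideal T | Q.IsPrime ∧ Ideal.comap A.subtype Q = ⊥} = G ∧
      ∀ (J : Ideal A) (_hJ : J.IsPrime), J ≠ ⊥ →
        Nonempty (TensorProduct A T (ResidueField (Localization.AtPrime J)) ≃+*
          ResidueField (Localization.AtPrime J)) := by
  have hE_prime : ∀ Q ∈ G', Q.IsPrime := by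
    subst hG'
    rintro Q (hQ | rfl)
    · exact hQ.isPrime
    · exact hP
  have hE_fin : G'.Finite := by
    subst hG'
    exact (associatedPrimes.finite T T).union (Set.finite_singleton P)
  have hreg_notMem : ∀ x ∈ nonZeroDivisors T, ∀ Q ∈ associatedPrimes T T, x ∉ Q := by
    intro x hx Q hQ hxQ
    have : x ∈ ⋃ Q ∈ associatedPrimes T T, (Q : Set T) := Set.mem_biUnion hQ hxQ
    rw [biUnion_associatedPrimes_eq_compl_nonZeroDivisors] at this
    exact this hx
  have hE_max : maximalIdeal T ∉ G' := by
    subst hG'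
    rintro (h | h)
    · exact hreg_notMem (y 0) (hy 0).1 _ h (hy 0).2.1
    · exact hPm h.symm
  have hE_int : ∀ Q ∈ G', ∀ x ∈ (Int.castRingHom T).range, x ∈ Q → x = 0 := by
    subst hG'
    rintro Q (hQ | rfl) x hx hxQ
    · by_contra hx0
      exact hreg_notMem x (hreg x hx hx0) Q hQ hxQ
    · exact hPiP x hx hxQ
  have hE_ass : associatedPrimes T T ⊆ G' := hG' ▸ Set.subset_union_left
  have hPE : P ∈ G' := by simp [hG']
  have hm_notLe : ∀ Q ∈ G', ¬ maximalIdeal T ≤ Q := fun Q hQ hle =>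
    hE_max ((le_antisymm hle (le_maximalIdeal (hE_prime Q hQ).ne_top)) ▸ hQ)
  obtain ⟨A₀, hA₀, hcoset₀⟩ := exists_subring_meets_cosets hE_fin hE_prime hE_max hE_int
  let A := A₀.regularSaturation
  have hA : ∀ Q ∈ G', ∀ x ∈ A, x ∈ Q → x = 0 := fun Q hQ x hx hxQ =>
    Subring.eq_zero_of_mem_regularSaturation (hA₀ Q hQ) hx hxQ
  have hcoset : ∀ (u : T) (I : Ideal T), (∀ Q ∈ G', ¬ I ≤ Q) → ∃ v ∈ A, v - u ∈ I := by
    intro u I hI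
    obtain ⟨v, hv, hvu⟩ := hcoset₀ u I hI
    exact ⟨v, A₀.le_regularSaturation hv, hvu⟩
  have hA_reg : ∀ a ∈ A, a ≠ 0 → a ∈ nonZeroDivisors T := by
    intro a ha ha0
    by_contra h
    have : a ∈ ⋃ Q ∈ associatedPrimes T T, (Q : Set T) := by
      rw [biUnion_associatedPrimes_eq_compl_nonZeroDivisors]
      exact h
    obtain ⟨Q, hQ, haQ⟩ := Set.mem_iUnion₂.1 this
    exact ha0 (hA Q (hE_ass hQ) a ha haQ)
  have hclosed : ∀ a ∈ A, a ≠ 0 → ∀ t, a * t ∈ A → t ∈ A := fun a ha ha0 t hat =>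
    Subring.mem_regularSaturation_of_mul_mem ha (hA_reg a ha ha0) hat
  have hspan : ∀ a ∈ A, a ≠ 0 → ∀ Q ∈ G', ¬ Ideal.span {a} ≤ Q := fun a ha ha0 Q hQ hle =>
    ha0 (hA Q hQ a ha (hle (Ideal.mem_span_singleton_self a)))
  have hcomap : ∀ J : Ideal A, (J.map A.subtype).comap A.subtype = J :=
    Subring.comap_map_of_surjective_mod hclosed
      fun a ha ha0 u => hcoset u _ (hspan a ha ha0)
  have hdom : IsDomain A := by
    have : NoZeroDivisors A := ⟨fun {a b} hab => by
      by_contra! h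
      have ha := hA_reg a a.2 fun h0 => h.1 (Subtype.ext h0)
      exact h.2 (Subtype.ext ((mul_left_mem_nonZeroDivisors_eq_zero_iff ha).1
        (congrArg Subtype.val hab)))⟩
    exact NoZeroDivisors.to_isDomain A
  have hlocHom : IsLocalHom A.subtype := ⟨fun a ha => by
    obtain ⟨b, hb⟩ := isUnit_iff_exists_inv.1 ha
    have ha0 : (a : T) ≠ 0 := ha.ne_zero
    have hbA : b ∈ A := hclosed a a.2 ha0 b (by
      rw [show (a : T) * b = 1 from hb]
      exact one_mem A)
    exact isUnit_iff_exists_inv.2 ⟨⟨b, hbA⟩, Subtype.ext hb⟩⟩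
  have hloc : IsLocalRing A := A.subtype.domain_isLocalRing
  have hmax_eq : (maximalIdeal T).comap A.subtype = maximalIdeal A := by
    ext a
    rw [Ideal.mem_comap, mem_maximalIdeal, mem_maximalIdeal, mem_nonunits_iff, mem_nonunits_iff,
      isUnit_map_iff]
  have hpow_notLe : ∀ k, ∀ Q ∈ G', ¬ maximalIdeal T ^ k ≤ Q := fun k Q hQ hle =>
    have := hE_prime Q hQ
    hm_notLe Q hQ (this.le_of_pow_le hle)
  have hmap_max : ((maximalIdeal T).comap A.subtype).map A.subtype = maximalIdeal T := by
    refine le_antisymm Ideal.map_comap_le ?_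
    refine Submodule.le_of_le_smul_of_le_jacobson_bot (I := maximalIdeal T)
      (maximalIdeal T).fg_of_isNoetherianRing (maximalIdeal_le_jacobson ⊥) fun t ht => ?_
    obtain ⟨v, hv, hvt⟩ := hcoset t _ (hpow_notLe 2)
    have hvm : v ∈ maximalIdeal T := by
      have := add_mem (Ideal.pow_le_self two_ne_zero hvt) ht
      rwa [sub_add_cancel] at this
    rw [← sub_sub_self v t]
    refine sub_mem (Submodule.mem_sup_left ?_) (Submodule.mem_sup_right ?_)
    · have hv_mem : (⟨v, hv⟩ : A) ∈ (maximalIdeal T).comap A.subtype := hvm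
      exact Ideal.mem_map_of_mem A.subtype hv_mem
    · rwa [smul_eq_mul, ← pow_two]
  refine ⟨A, hdom, A.subtype.isNoetherianRing_of_comap_map hcomap, hloc, ?_, ?_, ?_, ?_, ?_, ?_⟩
  · rw [hmax_eq]
    exact maximalIdeal.isMaximal A
  · refine AdicCompletion.nonempty_ringEquiv_of_comap_pow A.subtype _ (maximalIdeal T)
      (fun k => ?_) fun k t => ?_
    · rw [← hcomap ((maximalIdeal T).comap A.subtype ^ k), Ideal.map_pow, hmap_max]
    · obtain ⟨v, hv, hvt⟩ := hcoset t _ (hpow_notLe k)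
      exact ⟨⟨v, hv⟩, hvt⟩
  · exact (Submodule.eq_bot_iff _).2 fun x hx => Subtype.ext (hA P hPE x x.2 hx)
  · intro i
    obtain ⟨hyreg, -, hyP⟩ := hy i
    have hyE : ∀ Q ∈ G', y i ∉ Q := by
      subst hG'
      rintro Q (hQ | rfl)
      · exact hreg_notMem _ hyreg Q hQ
      · exact hyP
    obtain ⟨v, hv, hvy⟩ := hcoset (y i) (Ideal.span {y i} * maximalIdeal T) fun Q hQ hle =>
      ((hE_prime Q hQ).mul_le.1 hle).elim
        (fun h => hyE Q hQ (h (Ideal.mem_span_singleton_self _))) (hm_notLe Q hQ)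
    obtain ⟨z, hz, hzv⟩ := Ideal.mem_span_singleton_mul.1 hvy
    have hunit : IsUnit (1 + z) := by
      by_contra h
      have h1 := sub_mem ((mem_maximalIdeal _).2 h) hz
      rw [add_sub_cancel_right] at h1
      exact (maximalIdeal.isMaximal T).ne_top ((Ideal.eq_top_iff_one _).2 h1)
    refine ⟨hunit.unit, ?_⟩
    rw [IsUnit.unit_spec, mul_add, mul_one, hzv, add_sub_cancel]
    exact hv
  · subst hG
    ext Q
    simp only [Set.mem_ofPred_eq]
    refine and_congr_right fun hQ => ⟨fun hQA => ?_, ?_⟩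
    · by_contra! h
      have hQm : ∀ Q' ∈ G', ¬ maximalIdeal T * Q ≤ Q' := fun Q' hQ' hle =>
        ((hE_prime Q' hQ').mul_le.1 hle).elim (hm_notLe Q' hQ') (h Q' hQ')
      have hlt : ¬ Q ≤ maximalIdeal T * Q := by
        intro hle
        have hQ0 : Q = ⊥ := Submodule.eq_bot_of_le_smul_of_le_jacobson_bot (maximalIdeal T) Q
          Q.fg_of_isNoetherianRing hle (maximalIdeal_le_jacobson ⊥)
        exact h P hPE (hQ0 ▸ bot_le)
      obtain ⟨q, hqQ, hq⟩ := SetLike.not_le_iff_exists.1 hlt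
      obtain ⟨v, hv, hvq⟩ := hcoset q _ hQm
      have hvQ : v ∈ Q := by
        have := add_mem (Ideal.mul_le_right hvq) hqQ
        rwa [sub_add_cancel] at this
      have hv0 : (⟨v, hv⟩ : A) = 0 := by
        have : (⟨v, hv⟩ : A) ∈ Q.comap A.subtype := hvQ
        rwa [hQA] at this
      have hv0' : v = 0 := congrArg Subtype.val hv0
      rw [hv0', zero_sub, neg_mem_iff] at hvq
      exact hq hvq
    · rintro ⟨Q', hQ', hle⟩
      exact (Submodule.eq_bot_iff _).2 fun x hx => Subtype.ext (hA Q' hQ' x x.2 (hle hx))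
  · intro J hJ hJ0
    obtain ⟨a, haJ, ha0⟩ := Submodule.exists_mem_ne_zero_of_ne_bot hJ0
    refine Algebra.TensorProduct.nonempty_ringEquiv_of_comap_map J (fun j hj => ?_) (hcomap J)
      fun t => ?_
    · rw [IsScalarTower.algebraMap_apply A (Localization.AtPrime J), ResidueField.algebraMap_eq,
        residue_eq_zero_iff]
      exact (IsLocalization.AtPrime.to_map_mem_maximal_iff _ J j).2 hj
    · obtain ⟨v, hv, hvt⟩ := hcoset t (J.map A.subtype) fun Q hQ hle =>
        ha0 (Subtype.ext (hA Q hQ a a.2 (hle (Ideal.mem_map_of_mem _ haJ))))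
      exact ⟨⟨v, hv⟩, hvt⟩
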